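/- arXiv:1305.1984 — 4 statements merged into one kernel-verified Lean document; each statement's English description precedes it below -/
import Mathlib

section
/- Let n ≥ 1 be an integer and set k := ⌊4·b(n)⌋. For every integer m with k < m ≤ n one has F(m) > F(k). Consequently, every m ∈ {1,…,n} at which F attains its minimum over {1,…,n} satisfies m ≤ ⌊4·b(n)⌋; in particular the optimal cleanup size in model 𝓜₄ is less than 4·log₂(n+1). -/
/-- `stirling2 a b` is the Stirling number of the second kind: the number of
partitions of an `a`-element set into `b` nonempty blocks. -/
def stirling2 : ℕ → ℕ → ℕ
  | 0, 0 => 1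
  | 0, _ + 1 => 0
  | _ + 1, 0 => 0
  | a + 1, b + 1 => (b + 1) * stirling2 a (b + 1) + stirling2 a b

/-- `pathSet n m ℓ` is the set `𝒳_m^{(ℓ)}` of sequences `(χ_1, …, χ_ℓ)` of length `ℓ`
with entries in an `n`-element set such that the set of entries has exactly `m` elements
and the last entry is distinct from all previous entries. -/
def pathSet (n m ℓ : ℕ) : Finset (Fin ℓ → Fin n) :=
  Finset.univ.filter (fun χ =>
    (Finset.image χ Finset.univ).card = m ∧
    ∀ t s : Fin ℓ, (t : ℕ) < ℓ - 1 → (s : ℕ) = ℓ - 1 → χ t ≠ χ s)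

/-- `prior χ t` is the set `{χ_1, …, χ_{t−1}}` of values occurring strictly before
position `t` in the sequence `χ`. -/
def prior {n ℓ : ℕ} (χ : Fin ℓ → Fin n) (t : Fin ℓ) : Finset (Fin n) :=
  (Finset.univ.filter (fun s => s < t)).image χ

/-- `tau j χ` is `τ_j(χ)`: the number of indices `t` with
`χ_t ∈ {χ_1, …, χ_{t−1}}` and `|{χ_1, …, χ_{t−1}}| = j`. -/
def tau {n ℓ : ℕ} (j : ℕ) (χ : Fin ℓ → Fin n) : ℕ :=
  (Finset.univ.filter (fun t => χ t ∈ prior χ t ∧ (prior χ t).card = j)).card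

/-- `E_m[τ_j/ℓ] := Σ_{ℓ=m}^∞ (1/(ℓ·n^ℓ))·Σ_{χ∈𝒳_m^{(ℓ)}} τ_j(χ)`.  (The terms with
`ℓ < m` vanish since `𝒳_m^{(ℓ)} = ∅` for `ℓ < m`.) -/
noncomputable def Etau (n m j : ℕ) : ℝ :=
  ∑' ℓ : ℕ, (∑ χ ∈ pathSet n m ℓ, (tau j χ : ℝ)) / (ℓ * n ^ ℓ)

/-- `E_m[1/ℓ] := Σ_{ℓ=m}^∞ |𝒳_m^{(ℓ)}|/(ℓ·n^ℓ)`, the expected reciprocal of the waiting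
time until `m` distinct values have appeared in i.i.d. uniform draws from an `n`-element
set.  (The terms with `ℓ < m` vanish since `𝒳_m^{(ℓ)} = ∅` for `ℓ < m`.) -/
noncomputable def ErecipP (n m : ℕ) : ℝ :=
  ∑' ℓ : ℕ, ((pathSet n m ℓ).card : ℝ) / (ℓ * n ^ ℓ)

/-- `b(n) := (1 + 1/n)·log₂(n+1) − 1`, the average cost of a successful binary search
among `n` sorted items. -/
noncomputable def bcost (n : ℕ) : ℝ := (1 + 1 / (n : ℝ)) * Real.logb 2 ((n : ℝ) + 1) - 1

/-- `F(m) := 2·m·b(n)·E_m[1/ℓ] + Σ_{j=1}^{m−1} ((j+1)/2)·E_m[τ_j/ℓ]`, the expected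
per-search cost of the search-with-cleanup process in the complete-memory,
numbered-shelves model `𝓜₄` with uniform distribution, when one cleans up as soon as
the pile reaches size `m`. -/
noncomputable def Fcost (n m : ℕ) : ℝ :=
  2 * m * bcost n * ErecipP n m +
    ∑ j ∈ Finset.Icc 1 (m - 1), (((j : ℝ) + 1) / 2) * Etau n m j

section helpers
open Finset

/-- restriction to the first ℓ entries -/
def rr {n : ℕ} (ℓ : ℕ) (ω : ℕ → Fin n) : Fin ℓ → Fin n := fun i => ω i

/-- number of distinct values before time t -/
def cc {n : ℕ} (ω : ℕ → Fin n) (t : ℕ) : ℕ := ((range t).image ω).card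

lemma cc_succ_new {n : ℕ} (ω : ℕ → Fin n) (t : ℕ) (h : ω t ∉ (range t).image ω) :
    cc ω (t+1) = cc ω t + 1 := by
  unfold cc
  rw [range_add_one, image_insert, card_insert_of_notMem h]

lemma cc_succ_old {n : ℕ} (ω : ℕ → Fin n) (t : ℕ) (h : ω t ∈ (range t).image ω) :
    cc ω (t+1) = cc ω t := by
  unfold cc
  rw [range_add_one, image_insert, insert_eq_of_mem h]

lemma cc_mono {n : ℕ} (ω : ℕ → Fin n) : Monotone (cc ω) := by
  intro a b h
  exact card_le_card (image_subset_image (range_subset_range.2 h))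

lemma cc_zero {n : ℕ} (ω : ℕ → Fin n) : cc ω 0 = 0 := by simp [cc]

lemma image_rr {n : ℕ} (ω : ℕ → Fin n) (ℓ : ℕ) :
    Finset.image (rr ℓ ω) Finset.univ = (range ℓ).image ω := by
  ext x
  simp only [mem_image, mem_univ, true_and, mem_range, rr]
  constructor
  · rintro ⟨a, rfl⟩; exact ⟨a, a.2, rfl⟩
  · rintro ⟨a, h, rfl⟩; exact ⟨⟨a, h⟩, rfl⟩

lemma prior_rr {n : ℕ} (ω : ℕ → Fin n) (ℓ : ℕ) (t : Fin ℓ) :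
    prior (rr ℓ ω) t = (range t).image ω := by
  ext x
  simp only [prior, mem_image, mem_filter, mem_univ, true_and, mem_range, rr]
  constructor
  · rintro ⟨a, h, rfl⟩; exact ⟨a, h, rfl⟩
  · rintro ⟨a, h, rfl⟩; exact ⟨⟨a, h.trans t.2⟩, h, rfl⟩

lemma mem_pathSet_succ {n : ℕ} (ω : ℕ → Fin n) (m L : ℕ) :
    rr (L+1) ω ∈ pathSet n m (L+1) ↔ cc ω (L+1) = m ∧ ω L ∉ (range L).image ω := by
  unfold pathSet
  rw [mem_filter, image_rr]
  simp only [mem_univ, true_and, cc, rr, mem_image, mem_range, not_exists, not_and]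
  refine and_congr_right fun _ => ?_
  constructor
  · intro h x hx
    exact h ⟨x, by omega⟩ ⟨L, by omega⟩ (by simpa using hx) (by simp)
  · intro h t s ht hs
    have := h t (by simpa using ht)
    have e : (s : ℕ) = L := by simpa using hs
    rw [e]; exact this

lemma pathSet_zero (n m : ℕ) (hm : 1 ≤ m) : pathSet n m 0 = ∅ := by
  unfold pathSet
  apply Finset.filter_false_of_mem
  intro x _ h
  have := h.1
  simp at this
  omega

/-- hitting step -/
def hit {n : ℕ} (ω : ℕ → Fin n) (m L : ℕ) : Prop :=
  cc ω (L+1) = m ∧ ω L ∉ (range L).image ω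

lemma hit_cc {n : ℕ} {ω : ℕ → Fin n} {m L : ℕ} (h : hit ω m L) : cc ω L + 1 = m := by
  rw [← cc_succ_new ω L h.2, h.1]

lemma hit_lt {n : ℕ} {ω : ℕ → Fin n} {m L k K : ℕ} (h : hit ω m L) (h' : hit ω k K)
    (hkm : k < m) : K < L := by
  by_contra hc
  have := cc_mono ω (show L ≤ K by omega)
  have := hit_cc h; have := hit_cc h'; omega

lemma hit_unique {n : ℕ} {ω : ℕ → Fin n} {m L K : ℕ} (h : hit ω m L) (h' : hit ω m K) :
    L = K := by
  have := hit_cc h; have := hit_cc h'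
  have h1 := h.1; have h2 := h'.1
  rcases lt_trichotomy L K with hc | hc | hc
  · have := cc_mono ω (show L + 1 ≤ K by omega); omega
  · exact hc
  · have := cc_mono ω (show K + 1 ≤ L by omega); omega

lemma hit_exists {n : ℕ} (ω : ℕ → Fin n) (m : ℕ) (hm : 1 ≤ m) (N : ℕ) (h : m ≤ cc ω N) :
    ∃ L < N, hit ω m L := by
  induction N with
  | zero => rw [cc_zero] at h; omega
  | succ N ih =>
    by_cases h2 : m ≤ cc ω N
    · obtain ⟨L, hL, h⟩ := ih h2
      exact ⟨L, by omega, h⟩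
    · refine ⟨N, by omega, ?_⟩
      by_cases hn : ω N ∈ (range N).image ω
      · rw [cc_succ_old _ _ hn] at h; omega
      · have := cc_succ_new _ _ hn
        exact ⟨by omega, hn⟩

/-- the per-path sum -/
noncomputable def HH {n : ℕ} (q : ∀ ℓ : ℕ, (Fin ℓ → Fin n) → ℝ) (m N : ℕ) (ω : ℕ → Fin n) : ℝ :=
  ∑ ℓ ∈ range (N+1), if rr ℓ ω ∈ pathSet n m ℓ then q ℓ (rr ℓ ω) else 0

lemma HH_hit {n : ℕ} (q : ∀ ℓ : ℕ, (Fin ℓ → Fin n) → ℝ) (m N : ℕ) (hm : 1 ≤ m) (ω : ℕ → Fin n)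
    (L : ℕ) (hL : L < N) (h : hit ω m L) : HH q m N ω = q (L+1) (rr (L+1) ω) := by
  unfold HH
  rw [sum_eq_single (L+1)]
  · rw [if_pos ((mem_pathSet_succ ω m L).2 h)]
  · intro b _ hb
    rw [if_neg]
    intro hc
    cases b with
    | zero => rw [pathSet_zero n m hm] at hc; simp at hc
    | succ b => exact hb (by rw [hit_unique ((mem_pathSet_succ ω m b).1 hc) h])
  · intro h; simp at h; omega

lemma HH_no {n : ℕ} (q : ∀ ℓ : ℕ, (Fin ℓ → Fin n) → ℝ) (m N : ℕ) (hm : 1 ≤ m) (ω : ℕ → Fin n)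
    (h : ¬ ∃ L < N, hit ω m L) : HH q m N ω = 0 := by
  unfold HH
  apply sum_eq_zero
  intro b hb
  rw [if_neg]
  intro hc
  cases b with
  | zero => rw [pathSet_zero n m hm] at hc; simp at hc
  | succ b => exact h ⟨b, by simpa using hb, (mem_pathSet_succ ω m b).1 hc⟩

lemma HH_le {n : ℕ} (q : ∀ ℓ : ℕ, (Fin ℓ → Fin n) → ℝ) (m N : ℕ) (hm : 1 ≤ m) (ω : ℕ → Fin n)
    (B : ℝ) (hB : 0 ≤ B) (h : ∀ L, hit ω m L → q (L+1) (rr (L+1) ω) ≤ B) : HH q m N ω ≤ B := by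
  by_cases hx : ∃ L < N, hit ω m L
  · obtain ⟨L, hL, hh⟩ := hx
    rw [HH_hit q m N hm ω L hL hh]; exact h L hh
  · rw [HH_no q m N hm ω hx]; exact hB

/-- step cost -/
noncomputable def stepc {n : ℕ} (b : ℝ) (ω : ℕ → Fin n) (t : ℕ) : ℝ :=
  if ω t ∈ (range t).image ω then ((cc ω t : ℝ) + 1) / 2 else 2 * b

/-- per-path cost -/
noncomputable def gg {n : ℕ} (b : ℝ) (m : ℕ) (ℓ : ℕ) (χ : Fin ℓ → Fin n) : ℝ :=
  (2 * m * b + ∑ j ∈ Finset.Icc 1 (m-1), (((j:ℝ)+1)/2) * (tau j χ : ℝ)) / ℓ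

lemma tau_rr {n : ℕ} (ω : ℕ → Fin n) (ℓ j : ℕ) :
    (tau j (rr ℓ ω) : ℝ) =
      ∑ t ∈ range ℓ, if (ω t ∈ (range t).image ω ∧ cc ω t = j) then (1:ℝ) else 0 := by
  unfold tau
  rw [Finset.card_filter, Finset.sum_range]
  push_cast
  apply Finset.sum_congr rfl
  intro t _
  rw [prior_rr]
  rfl

lemma cc_eq_sum {n : ℕ} (ω : ℕ → Fin n) (ℓ : ℕ) :
    (cc ω ℓ : ℝ) = ∑ t ∈ range ℓ, if ω t ∈ (range t).image ω then (0:ℝ) else 1 := by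
  induction ℓ with
  | zero => simp [cc_zero]
  | succ N ih =>
    rw [sum_range_succ, ← ih]
    split_ifs with h
    · rw [cc_succ_old _ _ h]; simp
    · rw [cc_succ_new _ _ h]; simp

lemma gg_hit {n : ℕ} (b : ℝ) (m : ℕ) (ω : ℕ → Fin n) (L : ℕ) (h : hit ω m L) :
    gg b m (L+1) (rr (L+1) ω) = (∑ t ∈ range (L+1), stepc b ω t) / ((L+1 : ℕ) : ℝ) := by
  unfold gg
  congr 1
  have h1 : (m:ℝ) = (cc ω (L+1) : ℝ) := by rw [h.1]
  simp only [tau_rr]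
  simp_rw [mul_sum]
  rw [sum_comm]
  rw [show 2 * (m:ℝ) * b = (m:ℝ) * (2*b) by ring, h1, cc_eq_sum, sum_mul, ← sum_add_distrib]
  apply sum_congr rfl
  intro t ht
  unfold stepc
  by_cases hr : ω t ∈ (range t).image ω
  · rw [if_pos hr, if_pos hr, zero_mul, zero_add]
    rw [sum_eq_single (cc ω t)]
    · simp [hr]
    · intro j _ hj
      rw [if_neg (fun hc => hj hc.2.symm), mul_zero]
    · intro hn
      exfalso
      apply hn
      rw [Finset.mem_Icc]
      have := hit_cc h
      have := cc_mono ω (show t ≤ L by simp at ht; omega)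
      have : 0 < cc ω t := card_pos.2 ⟨_, hr⟩
      omega
  · simp [hr]

lemma path_le {n : ℕ} (b : ℝ) (k : ℕ) (hk1 : (k:ℝ) ≤ 4 * b) (ω : ℕ → Fin n) (K : ℕ)
    (h : hit ω k K) : ∑ t ∈ range (K+1), stepc b ω t ≤ 2 * b * ((K+1 : ℕ) : ℝ) := by
  have : ∀ t ∈ range (K+1), stepc b ω t ≤ 2 * b := by
    intro t ht
    unfold stepc
    split_ifs
    · have h1 := hit_cc h
      have h2 := cc_mono ω (show t ≤ K by simp at ht; omega)
      have : (cc ω t : ℝ) + 1 ≤ k := by exact_mod_cast (show cc ω t + 1 ≤ k by omega)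
      linarith
    · exact le_rfl
  have := sum_le_sum this
  simp only [sum_const, card_range, nsmul_eq_mul] at this
  linarith

lemma stepc_ge {n : ℕ} (b : ℝ) (k : ℕ) (hk2 : 4 * b < (k:ℝ) + 1) (ω : ℕ → Fin n) (t : ℕ)
    (h : k ≤ cc ω t) : 2 * b ≤ stepc b ω t := by
  unfold stepc
  split_ifs
  · have : (k : ℝ) ≤ cc ω t := by exact_mod_cast h
    linarith
  · exact le_rfl

lemma path_main {n : ℕ} (b : ℝ) (k m : ℕ) (hk2 : 4 * b < (k:ℝ) + 1)
    (hkm : k < m) (ω : ℕ → Fin n) (K L : ℕ) (h : hit ω k K) (h' : hit ω m L) :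
    ∑ t ∈ range (K+1), stepc b ω t + 2 * b * ((L:ℝ) - K)
      + (if ω (K+1) ∈ (range (K+1)).image ω then ((k:ℝ)+1)/2 - 2*b else 0)
      ≤ ∑ t ∈ range (L+1), stepc b ω t := by
  have hKL := hit_lt h' h hkm
  obtain ⟨d, rfl⟩ : ∃ d, L = K + 1 + d := ⟨L - (K+1), by omega⟩
  rw [show K + 1 + d + 1 = (K+1) + (d+1) by ring, sum_range_add _ (K+1) (d+1), sum_range_succ' _ d]
  have h1 : ∀ i ∈ range d, 2 * b ≤ stepc b ω (K+1+(i+1)) := by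
    intro i _
    apply stepc_ge b k hk2
    have := h.1
    have := cc_mono ω (show K + 1 ≤ K + 1 + (i+1) by omega)
    omega
  have h2 := sum_le_sum h1
  simp only [sum_const, card_range, nsmul_eq_mul] at h2
  have h3 : 2 * b + (if ω (K+1) ∈ (range (K+1)).image ω then ((k:ℝ)+1)/2 - 2*b else 0)
      ≤ stepc b ω (K+1) := by
    unfold stepc
    have : (cc ω (K+1) : ℝ) = k := by rw [h.1]
    split_ifs
    · rw [this]; linarith
    · linarith
  push_cast
  simp only [add_zero]
  linarith

lemma H_le {n : ℕ} (b : ℝ) (hb : 0 ≤ b) (k N : ℕ) (hk : 1 ≤ k) (hk1 : (k:ℝ) ≤ 4 * b)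
    (ω : ℕ → Fin n) : HH (gg b k) k N ω ≤ 2 * b := by
  apply HH_le _ _ _ hk _ _ (by linarith)
  intro L hL
  rw [gg_hit b k ω L hL, div_le_iff₀ (by positivity)]
  exact path_le b k hk1 ω L hL

lemma H_nonneg {n : ℕ} (b : ℝ) (hb : 0 ≤ b) (k N : ℕ)
    (ω : ℕ → Fin n) : 0 ≤ HH (gg b k) k N ω := by
  unfold HH
  apply sum_nonneg
  intro ℓ _
  split_ifs
  · unfold gg; positivity
  · exact le_rfl

lemma H_main {n : ℕ} (b : ℝ) (k m N : ℕ) (hk : 1 ≤ k) (hk1 : (k:ℝ) ≤ 4 * b)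
    (hk2 : 4 * b < (k:ℝ) + 1) (hkm : k < m)
    (ω : ℕ → Fin n) (hc : m ≤ cc ω N) : HH (gg b k) k N ω ≤ HH (gg b m) m N ω := by
  obtain ⟨L, hLN, hL⟩ := hit_exists ω m (by omega) N hc
  obtain ⟨K, hKN, hK⟩ := hit_exists ω k (by omega) N (by omega)
  rw [HH_hit _ _ _ (by omega) _ L hLN hL, HH_hit _ _ _ hk _ K hKN hK, gg_hit _ _ _ _ hL,
    gg_hit _ _ _ _ hK]
  have h1 := path_main b k m hk2 hkm ω K L hK hL
  have h2 := path_le b k hk1 ω K hK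
  have h3 : (0:ℝ) ≤ (if ω (K+1) ∈ (range (K+1)).image ω then ((k:ℝ)+1)/2 - 2*b else 0) := by
    split_ifs <;> linarith
  have hKL : (K:ℝ) < L := by exact_mod_cast hit_lt hL hK hkm
  rw [div_le_div_iff₀ (by positivity) (by positivity)]
  push_cast at *
  set S := ∑ t ∈ range (K+1), stepc b ω t
  set S' := ∑ t ∈ range (L+1), stepc b ω t
  have h4 : S + 2 * b * ((L:ℝ) - K) ≤ S' := by linarith
  have h5 : 0 ≤ (2 * b * ((K:ℝ)+1) - S) * ((L:ℝ) - K) := mul_nonneg (by linarith) (by linarith)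
  have h6 : (S + 2 * b * ((L:ℝ) - K)) * ((K:ℝ)+1) ≤ S' * ((K:ℝ)+1) :=
    mul_le_mul_of_nonneg_right h4 (by positivity)
  nlinarith

/-- Strict gain on paths which start with k distinct values, repeat, and are done at m+1. -/
lemma H_strict {n : ℕ} (b : ℝ) (hb : 0 ≤ b) (k m N : ℕ) (hk : 1 ≤ k) (hk1 : (k:ℝ) ≤ 4 * b)
    (hk2 : 4 * b < (k:ℝ) + 1) (hkm : k < m) (hN : m + 1 ≤ N)
    (ω : ℕ → Fin n) (h1 : cc ω k = k) (h2 : ω k ∈ (range k).image ω) (h3 : cc ω (m+1) = m) :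
    HH (gg b k) k N ω + (((k:ℝ)+1)/2 - 2*b)/(m+1) ≤ HH (gg b m) m N ω := by
  obtain ⟨L, hLN, hL⟩ := hit_exists ω m (by omega) (m+1) h3.ge
  obtain ⟨K, hKN, hK⟩ := hit_exists ω k (by omega) k h1.ge
  have hKk : K + 1 = k := by
    have : cc ω (K+1) ≤ (range (K+1)).card := card_image_le
    rw [card_range, hK.1] at this
    omega
  have hle := H_le b hb k N hk hk1 ω
  rw [HH_hit _ _ _ (by omega) _ L (by omega) hL, gg_hit _ _ _ _ hL]
  rw [HH_hit _ _ _ hk _ K (by omega) hK, gg_hit _ _ _ _ hK] at *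
  have h4 := path_main b k m hk2 hkm ω K L hK hL
  rw [if_pos (by rw [hKk]; exact h2)] at h4
  have hnew : ∀ t ∈ range (K+1), stepc b ω t = 2 * b := by
    intro t ht
    unfold stepc
    rw [if_neg]
    intro hold
    have e : ∀ s, cc ω s ≤ s := fun s => by
      have : cc ω s ≤ (range s).card := card_image_le
      simpa using this
    have e2 : ∀ d, cc ω (t+1+d) ≤ t + d := by
      intro d
      induction d with
      | zero => have := cc_succ_old _ _ hold; have := e t; simp only [add_zero]; omega
      | succ d ih =>
        by_cases hh : ω (t+1+d) ∈ (range (t+1+d)).image ω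
        · have := cc_succ_old _ _ hh; rw [← add_assoc]; omega
        · have := cc_succ_new _ _ hh; rw [← add_assoc]; omega
    have := e2 (k - (t+1))
    simp at ht
    rw [show t + 1 + (k - (t+1)) = k by omega] at this
    omega
  rw [sum_congr rfl hnew] at *
  simp only [sum_const, card_range, nsmul_eq_mul] at *
  have hK0 : ((K+1:ℕ):ℝ) ≠ 0 := by positivity
  rw [mul_div_cancel_left₀ _ hK0]
  push_cast at *
  have hLm : (L:ℝ) ≤ m := by exact_mod_cast (show L ≤ m by omega)
  have h5 : (((k:ℝ)+1)/2 - 2*b)/(m+1) ≤ (((k:ℝ)+1)/2 - 2*b)/(L+1) := by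
    apply div_le_div_of_nonneg_left <;> [linarith; positivity; linarith]
  refine (add_le_add_right h5 _).trans ?_
  rw [← sub_nonneg]
  have : (0:ℝ) < (L:ℝ)+1 := by positivity
  rw [show ∀ x : ℝ, x / ((L:ℝ)+1) - (2 * b + (((k:ℝ)+1)/2 - 2*b)/(L+1)) =
    (x - 2*b*((L:ℝ)+1) - (((k:ℝ)+1)/2 - 2*b))/((L:ℝ)+1) by intro x; field_simp; ring]
  apply div_nonneg _ this.le
  linarith

/-- extension of a finite sequence -/
def ee {n N : ℕ} (hn : 0 < n) (ω : Fin N → Fin n) : ℕ → Fin n :=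
  fun i => if h : i < N then ω ⟨i, h⟩ else ⟨0, hn⟩

lemma sum_cyl {n : ℕ} (hn : 0 < n) (N ℓ : ℕ) (h : ℓ ≤ N) (f : (Fin ℓ → Fin n) → ℝ) :
    ∑ ω : Fin N → Fin n, f (rr ℓ (ee hn ω)) = (n:ℝ)^(N-ℓ) * ∑ χ, f χ := by
  obtain ⟨d, rfl⟩ := Nat.exists_eq_add_of_le h
  rw [← Equiv.sum_comp (Fin.appendEquiv ℓ d), Fintype.sum_prod_type]
  have : ∀ (a : Fin ℓ → Fin n) (b : Fin d → Fin n),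
      rr ℓ (ee hn (Fin.appendEquiv ℓ d (a, b))) = a := by
    intro a b
    ext i
    have hi : (i:ℕ) < ℓ + d := by omega
    simp only [rr, ee, hi, dif_pos]
    have := Fin.append_left a b i
    exact congrArg Fin.val this
  simp only [this]
  simp [mul_sum]

lemma partial_eq {n : ℕ} (hn : 0 < n) (q : ∀ ℓ : ℕ, (Fin ℓ → Fin n) → ℝ) (m N : ℕ) :
    ∑ ℓ ∈ range (N+1), (∑ χ ∈ pathSet n m ℓ, q ℓ χ) / (n:ℝ)^ℓ =
      (∑ ω : Fin N → Fin n, HH q m N (ee hn ω)) / (n:ℝ)^N := by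
  unfold HH
  rw [sum_comm, sum_div]
  apply sum_congr rfl
  intro ℓ hℓ
  have hℓ : ℓ ≤ N := by simp at hℓ; omega
  rw [sum_cyl hn N ℓ hℓ (fun χ => if χ ∈ pathSet n m ℓ then q ℓ χ else 0)]
  rw [← sum_filter]
  have : univ.filter (fun χ => χ ∈ pathSet n m ℓ) = pathSet n m ℓ := by ext; simp
  rw [this]
  have hn' : (n:ℝ) ≠ 0 := by positivity
  rw [div_eq_div_iff (by positivity) (by positivity)]
  have : (n:ℝ)^N = (n:ℝ)^(N-ℓ) * (n:ℝ)^ℓ := by rw [← pow_add]; congr 1; omega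
  rw [this]; ring

lemma summ {n : ℕ} (hn : 0 < n) (q : ∀ ℓ : ℕ, (Fin ℓ → Fin n) → ℝ) (m : ℕ) (hm : 1 ≤ m)
    (h0 : ∀ ℓ χ, 0 ≤ q ℓ χ) (h1 : ∀ ℓ χ, q ℓ χ ≤ 1) :
    Summable (fun ℓ : ℕ => (∑ χ ∈ pathSet n m ℓ, q ℓ χ) / (n:ℝ)^ℓ) := by
  have hnn : ∀ ℓ : ℕ, 0 ≤ (∑ χ ∈ pathSet n m ℓ, q ℓ χ) / (n:ℝ)^ℓ := fun ℓ =>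
    div_nonneg (sum_nonneg fun _ _ => h0 _ _) (by positivity)
  apply summable_of_sum_range_le (c := 1) hnn
  intro N
  refine (sum_le_sum_of_subset_of_nonneg (range_subset_range.2 (Nat.le_succ N))
    (fun _ _ _ => hnn _)).trans ?_
  rw [partial_eq hn, div_le_one (by positivity)]
  have : ∀ ω ∈ (univ : Finset (Fin N → Fin n)), HH q m N (ee hn ω) ≤ 1 := fun ω _ =>
    HH_le q m N hm _ 1 zero_le_one (fun _ _ => h1 _ _)
  refine (sum_le_sum this).trans ?_
  simp

lemma tau_le {n ℓ : ℕ} (j : ℕ) (χ : Fin ℓ → Fin n) : tau j χ ≤ ℓ := by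
  unfold tau
  exact (card_le_univ _).trans (by simp)

lemma Fcost_tendsto {n : ℕ} (hn : 0 < n) (m : ℕ) (hm : 1 ≤ m) :
    Filter.Tendsto (fun N : ℕ => (∑ ω : Fin N → Fin n, HH (gg (bcost n) m) m N (ee hn ω)) / (n:ℝ)^N)
      Filter.atTop (nhds (Fcost n m)) := by
  have s1 := summ hn (fun ℓ _ => 1/(ℓ:ℝ)) m hm (fun _ _ => by positivity) (fun ℓ _ => by
    rcases Nat.eq_zero_or_pos ℓ with h | h
    · simp [h]
    · rw [div_le_one (by positivity)]; exact_mod_cast h)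
  have s2 : ∀ j, _ := fun j => summ hn (fun ℓ χ => (tau j χ : ℝ)/(ℓ:ℝ)) m hm
    (fun _ _ => by positivity) (fun ℓ χ => by
      apply div_le_one_of_le₀ _ (by positivity)
      exact_mod_cast tau_le j χ)
  have e1 : ErecipP n m = ∑' ℓ : ℕ, (∑ χ ∈ pathSet n m ℓ, 1/(ℓ:ℝ)) / (n:ℝ)^ℓ := by
    unfold ErecipP
    congr 1; ext ℓ
    rw [sum_const, nsmul_eq_mul, mul_one_div, div_div]
  have e2 : ∀ j, Etau n m j = ∑' ℓ : ℕ, (∑ χ ∈ pathSet n m ℓ, (tau j χ : ℝ)/(ℓ:ℝ)) / (n:ℝ)^ℓ := by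
    intro j
    unfold Etau
    congr 1; ext ℓ
    rw [← sum_div, div_div]
  have hs1 := s1.hasSum.mul_left (2 * m * bcost n)
  have hs2 := hasSum_sum (fun j (_ : j ∈ Finset.Icc 1 (m-1)) =>
    (s2 j).hasSum.mul_left (((j:ℝ)+1)/2))
  have hs := hs1.add hs2
  have e3 : Fcost n m = 2 * m * bcost n * ErecipP n m +
    ∑ j ∈ Finset.Icc 1 (m - 1), (((j : ℝ) + 1) / 2) * Etau n m j := rfl
  simp_rw [e2] at e3
  rw [e1] at e3
  rw [e3]
  have ht := hs.tendsto_sum_nat.comp (Filter.tendsto_add_atTop_nat 1)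
  refine ht.congr ?_
  intro N
  rw [← partial_eq hn]
  simp only [Function.comp]
  apply sum_congr rfl
  intro ℓ _
  unfold gg
  simp_rw [add_div, sum_add_distrib, sum_div, mul_sum]
  rw [sum_comm (s := pathSet n m ℓ)]
  rw [add_div, sum_div, sum_div]
  congr 1
  · apply sum_congr rfl; intros; ring
  · apply sum_congr rfl; intro j _
    rw [sum_div]
    apply sum_congr rfl; intros; ring

/-- the special path -/
def vv (k i : ℕ) : ℕ := if i < k then i else if i = k then 0 else i - 1

lemma cc_val {n : ℕ} (ω : ℕ → Fin n) (t : ℕ) (v : ℕ → ℕ) (h : ∀ i < t, (ω i : ℕ) = v i) :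
    cc ω t = ((range t).image v).card := by
  unfold cc
  rw [← card_image_of_injective _ Fin.val_injective, image_image]
  congr 1
  apply image_congr
  intro i hi
  exact h i (by simpa using hi)

lemma special {n : ℕ} (k m : ℕ) (hk : 1 ≤ k) (hkm : k < m) (ω : ℕ → Fin n)
    (h : ∀ i < m+1, (ω i : ℕ) = vv k i) :
    cc ω k = k ∧ ω k ∈ (range k).image ω ∧ cc ω (m+1) = m := by
  refine ⟨?_, ?_, ?_⟩
  · rw [cc_val ω k id, image_id, card_range]
    intro i hi
    rw [h i (by omega)]; simp [vv, hi]
  · rw [mem_image]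
    refine ⟨0, mem_range.2 (by omega), ?_⟩
    apply Fin.val_injective
    rw [h 0 (by omega), h k (by omega)]
    simp [vv]
  · rw [cc_val ω (m+1) (vv k) h]
    have : (range (m+1)).image (vv k) = range m := by
      ext x
      simp only [mem_image, mem_range]
      constructor
      · rintro ⟨a, ha, rfl⟩
        unfold vv; split_ifs <;> omega
      · intro hx
        by_cases hxk : x < k
        · exact ⟨x, by omega, by simp [vv, hxk]⟩
        · refine ⟨x+1, by omega, ?_⟩
          unfold vv; split_ifs <;> omega
    rw [this, card_range]

lemma miss {n : ℕ} (hn : 0 < n) (m N : ℕ) (hmn : m ≤ n) :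
    ∑ ω : Fin N → Fin n, (if cc (ee hn ω) N < m then (1:ℝ) else 0) ≤ n * ((n:ℝ)-1)^N := by
  have h1 : ∀ ω : Fin N → Fin n, (if cc (ee hn ω) N < m then (1:ℝ) else 0) ≤
      ∑ a : Fin n, if ω ∈ Fintype.piFinset (fun _ : Fin N => univ.erase a) then (1:ℝ) else 0 := by
    intro ω
    split_ifs with h
    · have : ∃ a, a ∉ (range N).image (ee hn ω) := by
        by_contra hc
        push Not at hc
        have : (range N).image (ee hn ω) = univ := by ext; simp only [hc, mem_univ]
        unfold cc at h
        rw [this, card_univ, Fintype.card_fin] at h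
        omega
      obtain ⟨a, ha⟩ := this
      refine le_trans ?_ (single_le_sum (fun _ _ => by split_ifs <;> norm_num) (mem_univ a))
      rw [if_pos]
      rw [Fintype.mem_piFinset]
      intro i
      simp only [mem_erase, mem_univ, and_true]
      intro hc
      apply ha
      rw [mem_image]
      refine ⟨i, by simp, ?_⟩
      simp [ee, hc]
    · exact sum_nonneg fun _ _ => by split_ifs <;> norm_num
  refine (sum_le_sum fun ω _ => h1 ω).trans ?_
  rw [sum_comm]
  have : ∀ a : Fin n, (∑ ω : Fin N → Fin n,
      if ω ∈ Fintype.piFinset (fun _ : Fin N => univ.erase a) then (1:ℝ) else 0) = ((n:ℝ)-1)^N := by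
    intro a
    rw [← sum_filter, Finset.filter_univ_mem, sum_const, Fintype.card_piFinset]
    simp [Nat.cast_sub hn]
  rw [sum_congr rfl fun a _ => this a]
  simp

lemma key {n : ℕ} (hn : 0 < n) (k m : ℕ) (hb : 0 ≤ bcost n) (hk : 1 ≤ k)
    (hk1 : (k:ℝ) ≤ 4 * bcost n)
    (hk2 : 4 * bcost n < (k:ℝ) + 1) (hkm : k < m) (hmn : m ≤ n) : Fcost n k < Fcost n m := by
  set b := bcost n with hbd
  have hn0 : (0:ℝ) < n := by exact_mod_cast hn
  set δ : ℝ := (((k:ℝ)+1)/2 - 2*b)/(m+1) with hδ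
  have hδ0 : 0 < δ := div_pos (by linarith) (by positivity)
  let χ0 : Fin (m+1) → Fin n := fun i => ⟨vv k i, by unfold vv; split_ifs <;> omega⟩
  have hpath : ∀ N, m + 1 ≤ N → ∀ ω : Fin N → Fin n,
      HH (gg b k) k N (ee hn ω) + (if rr (m+1) (ee hn ω) = χ0 then δ else 0)
        - 2 * b * (if cc (ee hn ω) N < m then (1:ℝ) else 0) ≤ HH (gg b m) m N (ee hn ω) := by
    intro N hN ω
    by_cases h1 : rr (m+1) (ee hn ω) = χ0
    · have hv : ∀ i < m+1, (ee hn ω i : ℕ) = vv k i := by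
        intro i hi
        have := congrFun h1 ⟨i, hi⟩
        exact congrArg Fin.val this
      obtain ⟨a1, a2, a3⟩ := special k m hk hkm _ hv
      have := H_strict b hb k m N hk hk1 hk2 hkm hN _ a1 a2 a3
      rw [if_pos h1]
      have : 0 ≤ 2 * b * (if cc (ee hn ω) N < m then (1:ℝ) else 0) := by
        split_ifs <;> linarith
      linarith
    · rw [if_neg h1]
      split_ifs with h2
      · have := H_le b hb k N hk hk1 (ee hn ω)
        have := H_nonneg b hb m N (ee hn ω)
        linarith
      · have := H_main b k m N hk hk1 hk2 hkm (ee hn ω) (by omega)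
        linarith
  have hsum : ∀ N, m + 1 ≤ N →
      (∑ ω : Fin N → Fin n, HH (gg b k) k N (ee hn ω)) / (n:ℝ)^N + δ / (n:ℝ)^(m+1)
        - 2 * b * (n * (((n:ℝ)-1)/n)^N)
      ≤ (∑ ω : Fin N → Fin n, HH (gg b m) m N (ee hn ω)) / (n:ℝ)^N := by
    intro N hN
    have h1 := sum_le_sum fun ω (_ : ω ∈ (univ : Finset (Fin N → Fin n))) => hpath N hN ω
    rw [sum_sub_distrib, sum_add_distrib,
      sum_cyl hn N (m+1) hN (fun χ => if χ = χ0 then δ else 0), ← mul_sum] at h1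
    rw [sum_ite_eq' univ χ0 (fun _ => δ), if_pos (mem_univ _)] at h1
    have h2 := mul_le_mul_of_nonneg_left (miss hn m N hmn) (show 0 ≤ 2 * b by linarith)
    have hp : (n:ℝ)^N = (n:ℝ)^(N-(m+1)) * (n:ℝ)^(m+1) := by rw [← pow_add]; congr 1; omega
    rw [le_div_iff₀ (by positivity), sub_mul, add_mul, div_mul_cancel₀ _ (by positivity), div_pow]
    have e1 : δ / (n:ℝ)^(m+1) * (n:ℝ)^N = (n:ℝ)^(N-(m+1)) * δ := by
      rw [hp]; field_simp
    have e2 : 2 * b * (n * (((n:ℝ)-1)^N/(n:ℝ)^N)) * (n:ℝ)^N = 2 * b * (n * ((n:ℝ)-1)^N) := by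
      field_simp
    rw [e1, e2]
    linarith
  have hn1 : (1:ℝ) ≤ n := by exact_mod_cast hn
  have ht0 : Filter.Tendsto (fun N : ℕ => (((n:ℝ)-1)/n)^N) Filter.atTop (nhds 0) := by
    apply tendsto_pow_atTop_nhds_zero_of_lt_one
    · exact div_nonneg (by linarith) hn0.le
    · rw [div_lt_one hn0]; linarith
  have hL := ((Fcost_tendsto hn k hk).add_const (δ / (n:ℝ)^(m+1))).sub
    ((ht0.const_mul (n:ℝ)).const_mul (2*b))
  have := le_of_tendsto_of_tendsto hL (Fcost_tendsto hn m (by omega))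
    (Filter.eventually_atTop.2 ⟨m+1, fun N hN => hsum N hN⟩)
  have h3 : 0 < δ / (n:ℝ)^(m+1) := by positivity
  linarith

lemma logb_ge_one {n : ℕ} (hn : 1 ≤ n) : 1 ≤ Real.logb 2 ((n:ℝ)+1) := by
  rw [Real.le_logb_iff_rpow_le (by norm_num) (by positivity), Real.rpow_one]
  have : (1:ℝ) ≤ n := by exact_mod_cast hn
  linarith

lemma bcost_half {n : ℕ} (hn : 1 ≤ n) : 1/2 ≤ bcost n := by
  unfold bcost
  have h1 := logb_ge_one hn
  have hn0 : (1:ℝ) ≤ n := by exact_mod_cast hn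
  rcases le_or_gt n 2 with h | h
  · have : (1/2:ℝ) ≤ 1/n := by
      apply one_div_le_one_div_of_le (by linarith); exact_mod_cast h
    nlinarith
  · have h2 : 2 ≤ Real.logb 2 ((n:ℝ)+1) := by
      rw [Real.le_logb_iff_rpow_le (by norm_num) (by positivity)]
      have : (3:ℝ) ≤ n := by exact_mod_cast h
      norm_num; linarith
    have : 0 ≤ 1/(n:ℝ) := by positivity
    nlinarith

lemma bcost_lt {n : ℕ} (hn : 1 ≤ n) : bcost n ≤ Real.logb 2 ((n:ℝ)+1) := by
  unfold bcost
  have hn0 : (1:ℝ) ≤ n := by exact_mod_cast hn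
  have h : Real.logb 2 ((n:ℝ)+1) ≤ n := by
    rw [Real.logb_le_iff_le_rpow (by norm_num) (by positivity), Real.rpow_natCast]
    exact_mod_cast Nat.lt_two_pow_self (n := n)
  have : 1/(n:ℝ) * Real.logb 2 ((n:ℝ)+1) ≤ 1 := by
    rw [one_div, inv_mul_le_iff₀ (by linarith)]; linarith
  linarith

lemma bcost_slt {n : ℕ} (hn : 2 ≤ n) : bcost n < Real.logb 2 ((n:ℝ)+1) := by
  unfold bcost
  have hn0 : (2:ℝ) ≤ n := by exact_mod_cast hn
  have h : Real.logb 2 ((n:ℝ)+1) < n := by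
    rw [Real.logb_lt_iff_lt_rpow (by norm_num) (by positivity), Real.rpow_natCast]
    have : ∀ d : ℕ, d + 2 + 1 < 2^(d+2) := by
      intro d
      induction d with
      | zero => norm_num
      | succ d ih => rw [show d + 1 + 2 = (d+2)+1 by ring, pow_succ]; omega
    have := this (n-2)
    rw [show n - 2 + 2 = n by omega] at this
    exact_mod_cast this
  have : 1/(n:ℝ) * Real.logb 2 ((n:ℝ)+1) < 1 := by
    rw [one_div, inv_mul_lt_iff₀ (by linarith)]; linarith
  linarith

end helpers

/-- With `k := ⌊4·b(n)⌋`: for every `m` with `k < m ≤ n` one has `F(m) > F(k)`.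
Consequently every minimizer `m ∈ {1,…,n}` of `F` satisfies `m ≤ ⌊4·b(n)⌋`; in
particular the optimal cleanup size in model `𝓜₄` is less than `4·log₂(n+1)`. -/
theorem Fcost_min_le (n : ℕ) (hn : 1 ≤ n) (k : ℕ) (hk : k = ⌊4 * bcost n⌋₊) :
    (∀ m : ℕ, k < m → m ≤ n → Fcost n k < Fcost n m) ∧
    (∀ m ∈ Finset.Icc 1 n, (∀ m' ∈ Finset.Icc 1 n, Fcost n m ≤ Fcost n m') →
      m ≤ k ∧ (m : ℝ) < 4 * Real.logb 2 ((n : ℝ) + 1)) := by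
  have hb := bcost_half hn
  have h0 : 0 ≤ 4 * bcost n := by linarith
  have hk1 : (k:ℝ) ≤ 4 * bcost n := by rw [hk]; exact Nat.floor_le h0
  have hk2 : 4 * bcost n < (k:ℝ) + 1 := by rw [hk]; exact Nat.lt_floor_add_one _
  have hk0 : 1 ≤ k := by
    rw [hk]; apply Nat.le_floor; push_cast; linarith
  have hmain : ∀ m : ℕ, k < m → m ≤ n → Fcost n k < Fcost n m := fun m h1 h2 =>
    key hn k m (by linarith) hk0 hk1 hk2 h1 h2
  refine ⟨hmain, ?_⟩
  intro m hm hmin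
  rw [Finset.mem_Icc] at hm
  have hmk : m ≤ k := by
    by_contra hc
    have h1 := hmain m (by omega) hm.2
    have h2 := hmin k (Finset.mem_Icc.2 ⟨hk0, by omega⟩)
    linarith
  refine ⟨hmk, ?_⟩
  have hmk' : (m:ℝ) ≤ k := by exact_mod_cast hmk
  rcases Nat.lt_or_ge n 2 with h | h
  · have h1 := logb_ge_one hn
    have : m ≤ 1 := by omega
    have : (m:ℝ) ≤ 1 := by exact_mod_cast this
    linarith
  · have := bcost_slt h
    linarith
end

section
/- Let a, b, c be integers with a > 1 and c ≥ max{a, b}, and consider the real number T := Σ_{j=0}^{a−1} (a−j)(b−j)/(c−j). Then: (i) if 3b ≤ a − 2, then T < 0; (ii) if 3b > a and c ≥ 5a², then T > 0. -/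
theorem sum_aux (A B : ℝ) (n : ℕ) : ∑ j ∈ Finset.range n, (A - j) * (B - j) =
    n * A * B - (A + B) * (n * (n - 1) / 2) + n * (n - 1) * (2 * n - 1) / 6 := by
  induction n with
  | zero => simp
  | succ k ih => rw [Finset.sum_range_succ, ih]; push_cast; ring

/-- For integers `a, b, c` with `a > 1` and `c ≥ max{a, b}`, the sum
`T := Σ_{j=0}^{a−1} (a−j)(b−j)/(c−j)` satisfies: (i) if `3b ≤ a − 2` then `T < 0`;
(ii) if `3b > a` and `c ≥ 5a²` then `T > 0`. -/
theorem sum_sign (a b c : ℤ) (ha : 1 < a) (hca : a ≤ c) (hcb : b ≤ c) :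
    (3 * b ≤ a - 2 →
      ∑ j ∈ Finset.range a.toNat,
        ((a : ℝ) - j) * ((b : ℝ) - j) / ((c : ℝ) - j) < 0) ∧
    (a < 3 * b → 5 * a ^ 2 ≤ c →
      0 < ∑ j ∈ Finset.range a.toNat,
        ((a : ℝ) - j) * ((b : ℝ) - j) / ((c : ℝ) - j)) := by
  obtain ⟨n, rfl⟩ : ∃ n : ℕ, a = n := ⟨a.toNat, by omega⟩
  simp only [Int.toNat_natCast, Int.cast_natCast]
  have hn : (2 : ℝ) ≤ n := by exact_mod_cast ha
  have hcn : (n : ℝ) ≤ c := by exact_mod_cast hca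
  have hS : ∑ j ∈ Finset.range n, ((n : ℝ) - j) * ((b : ℝ) - j) =
      n * (n + 1) / 6 * (3 * b - n + 1) := by
    rw [sum_aux]; ring
  constructor
  · intro h
    have hb : 3 * (b : ℝ) ≤ n - 2 := by exact_mod_cast h
    have hbc : (0 : ℝ) < c - b := by
      have : b < c := by omega
      have : (b : ℝ) < c := by exact_mod_cast this
      linarith
    have key : ∑ j ∈ Finset.range n, ((n : ℝ) - j) * ((b : ℝ) - j) / ((c : ℝ) - j) ≤
        ∑ j ∈ Finset.range n, ((n : ℝ) - j) * ((b : ℝ) - j) / ((c : ℝ) - b) := by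
      apply Finset.sum_le_sum
      intro j hj
      have hj : (j : ℝ) < n := by exact_mod_cast Finset.mem_range.mp hj
      rw [div_le_div_iff₀ (by linarith) hbc]
      nlinarith [mul_nonneg (sub_nonneg.2 hj.le) (sq_nonneg ((b : ℝ) - j))]
    refine lt_of_le_of_lt key ?_
    rw [← Finset.sum_div, hS]
    apply div_neg_of_neg_of_pos _ hbc
    apply mul_neg_of_pos_of_neg <;> [positivity; linarith]
  · intro h h5
    have hb : (n : ℝ) + 1 ≤ 3 * b := by exact_mod_cast h
    have hc : 5 * (n : ℝ) ^ 2 ≤ c := by exact_mod_cast h5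
    have hc0 : (0 : ℝ) < c := by linarith
    have key : ∑ j ∈ Finset.range n, (((n : ℝ) - j) * ((b : ℝ) - j) - n / 4) / (c : ℝ) ≤
        ∑ j ∈ Finset.range n, ((n : ℝ) - j) * ((b : ℝ) - j) / ((c : ℝ) - j) := by
      apply Finset.sum_le_sum
      intro j hj
      have hj : (j : ℝ) < n := by exact_mod_cast Finset.mem_range.mp hj
      have hj0 : (0 : ℝ) ≤ j := by positivity
      rw [div_le_div_iff₀ hc0 (by linarith)]
      have h1 : 4 * (n : ℝ) ^ 2 ≤ c - j := by nlinarith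
      have h2 : ((n : ℝ) - j) * j ≤ n ^ 2 := by nlinarith
      have h3 : 0 ≤ ((n : ℝ) - j) * j := mul_nonneg (by linarith) hj0
      have h4 : (n : ℝ) / 4 * (4 * n ^ 2) ≤ n / 4 * (c - j) := by gcongr
      have h5 : ((n : ℝ) - j) * j * (-n) ≤ ((n : ℝ) - j) * j * (b - j) :=
        mul_le_mul_of_nonneg_left (by linarith) h3
      have h6 : ((n : ℝ) - j) * j * n ≤ n ^ 2 * n := by gcongr
      nlinarith
    refine lt_of_lt_of_le ?_ key
    rw [← Finset.sum_div, Finset.sum_sub_distrib, hS]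
    apply div_pos _ hc0
    simp only [Finset.sum_const, Finset.card_range, nsmul_eq_mul]
    have : (n : ℝ) * (n + 1) / 6 * 2 ≤ n * (n + 1) / 6 * (3 * b - n + 1) := by
      gcongr; linarith
    nlinarith
end

section
/- For all integers n, m with 1 ≤ m < n, one has F̃(m) > F̃(m+1) if and only if Σ_{j=0}^{m−1} ((m−j)/(n−j))·(4·b(n) − (m+j+1)) > 0. -/
/-- `E_m[ℓ] := Σ_{j=0}^{m−1} n/(n−j)`, the expected waiting time until `m` distinct values
have appeared in i.i.d. uniform draws from an `n`-element set. -/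
noncomputable def Ewait (n m : ℕ) : ℝ :=
  ∑ j ∈ Finset.range m, (n : ℝ) / ((n : ℝ) - j)

/-- `F̃(m) := (2·m·b(n) + (1/2)·Σ_{j=1}^{m−1} j(j+1)/(n−j)) / E_m[ℓ]`, the approximate
average total cost function for the complete-memory, numbered-shelves model `𝓜₄`. -/
noncomputable def Ftilde (n m : ℕ) : ℝ :=
  (2 * m * bcost n +
      (1 / 2) * ∑ j ∈ Finset.Icc 1 (m - 1), (j : ℝ) * ((j : ℝ) + 1) / ((n : ℝ) - j)) /
    Ewait n m

theorem aux_Icc (f : ℕ → ℝ) (h0 : f 0 = 0) (m : ℕ) :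
    ∑ j ∈ Finset.Icc 1 (m - 1), f j = ∑ j ∈ Finset.range m, f j := by
  apply Finset.sum_subset_zero_on_sdiff
  · intro j hj
    simp only [Finset.mem_Icc, Finset.mem_range] at *
    omega
  · intro j hj
    simp only [Finset.mem_sdiff, Finset.mem_Icc, Finset.mem_range] at hj
    have : j = 0 := by omega
    rw [this, h0]
  · intros; rfl

/-- `F̃(m) > F̃(m+1)` if and only if `Σ_{j=0}^{m−1} ((m−j)/(n−j))·(4·b(n) − (m+j+1)) > 0`. -/
theorem Ftilde_decreasing_iff (n m : ℕ) (hm : 1 ≤ m) (hmn : m < n) :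
    Ftilde n (m + 1) < Ftilde n m ↔
      0 < ∑ j ∈ Finset.range m,
        (((m : ℝ) - j) / ((n : ℝ) - j)) * (4 * bcost n - ((m : ℝ) + j + 1)) := by
  have hE : ∀ k, Ewait n k = n * ∑ j ∈ Finset.range k, 1 / ((n : ℝ) - j) := by
    intro k
    rw [Ewait, Finset.mul_sum]
    exact Finset.sum_congr rfl fun j _ => by ring
  have hsum : ∑ j ∈ Finset.range m,
        (((m : ℝ) - j) / ((n : ℝ) - j)) * (4 * bcost n - ((m : ℝ) + j + 1))
      = 4 * bcost n * m
        - (4 * bcost n * (n - m) + m * (m + 1)) * ∑ j ∈ Finset.range m, 1 / ((n : ℝ) - j)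
        + ∑ j ∈ Finset.range m, (j : ℝ) * ((j : ℝ) + 1) / ((n : ℝ) - j) := by
    have hc : 4 * bcost n * m = ∑ j ∈ Finset.range m, 4 * bcost n := by
      simp; ring
    rw [hc, Finset.mul_sum, ← Finset.sum_sub_distrib, ← Finset.sum_add_distrib]
    refine Finset.sum_congr rfl fun j hj => ?_
    have h1 : (j : ℝ) < n := by
      exact_mod_cast (Finset.mem_range.1 hj).trans hmn
    have h2 : (n : ℝ) - j ≠ 0 := (sub_pos.2 h1).ne'
    field_simp
    ring
  have hh : 0 < ∑ j ∈ Finset.range m, 1 / ((n : ℝ) - j) := by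
    refine Finset.sum_pos (fun j hj => ?_) ⟨0, Finset.mem_range.2 hm⟩
    have h1 : (j : ℝ) < n := by
      exact_mod_cast (Finset.mem_range.1 hj).trans hmn
    exact one_div_pos.2 (sub_pos.2 h1)
  rw [hsum]
  unfold Ftilde
  rw [aux_Icc (fun j : ℕ => (j : ℝ) * ((j : ℝ) + 1) / ((n : ℝ) - j)) (by simp),
    aux_Icc (fun j : ℕ => (j : ℝ) * ((j : ℝ) + 1) / ((n : ℝ) - j)) (by simp), hE, hE,
    Finset.sum_range_succ, Finset.sum_range_succ]
  generalize ∑ j ∈ Finset.range m, 1 / ((n : ℝ) - j) = h at *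
  generalize ∑ j ∈ Finset.range m, (j : ℝ) * ((j : ℝ) + 1) / ((n : ℝ) - j) = S at *
  generalize bcost n = b at *
  have hn : (0 : ℝ) < n := by exact_mod_cast (by omega : 0 < n)
  have hd : (0 : ℝ) < (n : ℝ) - m := sub_pos.2 (by exact_mod_cast hmn)
  have hd' : 0 < 1 / ((n : ℝ) - m) := one_div_pos.2 hd
  rw [div_lt_div_iff₀ (by positivity) (by positivity), ← sub_pos]
  push_cast
  have key : (2 * (m : ℝ) * b + 1 / 2 * S) * (n * (h + 1 / ((n : ℝ) - m)))
      - (2 * ((m : ℝ) + 1) * b + 1 / 2 * (S + m * (m + 1) / ((n : ℝ) - m))) * (n * h)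
      = (n / (2 * ((n : ℝ) - m))) * (4 * b * m - (4 * b * (n - m) + m * (m + 1)) * h + S) := by
    have := hd.ne'
    field_simp
    ring
  rw [key]
  exact mul_pos_iff_of_pos_left (by positivity)
end

section
/- For every integer n ≥ 5, the smallest m ∈ {1,…,n} at which F̃ attains its minimum over {1,…,n}, denoted m̃_opt(n), satisfies 3·b(n) − 3/2 ≤ m̃_opt(n) < 3·b(n) + 1/2; in other words, m̃_opt(n) equals either ⌈3·b(n) − 3/2⌉ or ⌈3·b(n) − 3/2⌉ + 1. -/
/-- The forward-difference discriminant. -/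
noncomputable def Ddisc (n m : ℕ) : ℝ :=
  ∑ j ∈ Finset.range m, (n : ℝ) / ((n : ℝ) - j) *
    (((m : ℝ) - j) * (((m : ℝ) + j + 1) / 2 - 2 * bcost n))

lemma Ewait_pos (n m : ℕ) (h1 : 1 ≤ m) (h : m ≤ n) : 0 < Ewait n m := by
  unfold Ewait
  apply Finset.sum_pos
  · intro j hj
    have hj' : j < n := lt_of_lt_of_le (Finset.mem_range.mp hj) h
    have h2 : (j : ℝ) < n := by exact_mod_cast hj'
    have h3 : (0 : ℝ) ≤ j := by positivity
    exact div_pos (by linarith) (by linarith)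
  · exact ⟨0, Finset.mem_range.mpr h1⟩

lemma sum_Icc_range (n m : ℕ) (h1 : 1 ≤ m) :
    ∑ j ∈ Finset.Icc 1 (m - 1), (j : ℝ) * ((j : ℝ) + 1) / ((n : ℝ) - j) =
    ∑ j ∈ Finset.range m, (j : ℝ) * ((j : ℝ) + 1) / ((n : ℝ) - j) := by
  apply Finset.sum_subset
  · intro j hj
    simp only [Finset.mem_Icc, Finset.mem_range] at *
    omega
  · intro j hj hj'
    simp only [Finset.mem_Icc, Finset.mem_range] at *
    have : j = 0 := by omega
    subst this
    simp

/-- Numerator. -/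
noncomputable def Nnum (n m : ℕ) : ℝ := 2 * m * bcost n +
      (1 / 2) * ∑ j ∈ Finset.range m, (j : ℝ) * ((j : ℝ) + 1) / ((n : ℝ) - j)

lemma Ftilde_eq (n m : ℕ) (h1 : 1 ≤ m) : Ftilde n m = Nnum n m / Ewait n m := by
  unfold Ftilde Nnum
  rw [sum_Icc_range n m h1]

lemma Ddisc_eq (n m : ℕ) (h : m < n) :
    Ddisc n m = (2 * bcost n * ((n : ℝ) - m) + m * (m + 1) / 2) * Ewait n m - n * Nnum n m := by
  have hN : Nnum n m = ∑ j ∈ Finset.range m,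
      (2 * bcost n + (1 / 2) * ((j : ℝ) * ((j : ℝ) + 1) / ((n : ℝ) - j))) := by
    rw [Finset.sum_add_distrib, ← Finset.mul_sum (Finset.range m) _ (1 / 2 : ℝ)]
    rw [Finset.sum_const, Finset.card_range, nsmul_eq_mul]
    unfold Nnum
    ring
  rw [hN]
  unfold Ddisc Ewait
  rw [Finset.mul_sum, Finset.mul_sum, ← Finset.sum_sub_distrib]
  apply Finset.sum_congr rfl
  intro j hj
  have hj' : j < n := lt_trans (Finset.mem_range.mp hj) h
  have h2 : (j : ℝ) < n := by exact_mod_cast hj'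
  have h3 : (n : ℝ) - j ≠ 0 := by linarith
  field_simp
  ring

lemma diff_eq (n m : ℕ) (h1 : 1 ≤ m) (h : m < n) :
    Ftilde n (m + 1) - Ftilde n m =
      Ddisc n m / (((n : ℝ) - m) * Ewait n m * Ewait n (m + 1)) := by
  rw [Ftilde_eq n m h1, Ftilde_eq n (m + 1) (by omega), Ddisc_eq n m h]
  have e1 := Ewait_pos n m h1 h.le
  have e2 := Ewait_pos n (m + 1) (by omega) (by omega)
  have h2 : (m : ℝ) < n := by exact_mod_cast h
  have h3 : (n : ℝ) - m ≠ 0 := by linarith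
  have hE : Ewait n (m + 1) = Ewait n m + n / ((n : ℝ) - m) := by
    unfold Ewait
    rw [Finset.sum_range_succ]
  have hN : Nnum n (m + 1) = Nnum n m + (2 * bcost n + (1 / 2) * ((m : ℝ) * (m + 1) / ((n : ℝ) - m))) := by
    unfold Nnum
    rw [Finset.sum_range_succ]
    push_cast
    ring
  rw [div_sub_div _ _ e2.ne' e1.ne', div_eq_div_iff (by positivity) (by positivity)]
  have key : Nnum n (m + 1) * Ewait n m - Ewait n (m + 1) * Nnum n m =
     ((2 * bcost n * ((n : ℝ) - m) + m * (m + 1) / 2) * Ewait n m - n * Nnum n m) / ((n : ℝ) - m) := by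
    rw [hE, hN]
    field_simp
    ring
  rw [key]
  field_simp

lemma sum_poly (k : ℕ) (a b c d : ℝ) :
    ∑ j ∈ Finset.range k, (a + b * (j : ℝ) + c * (j : ℝ) ^ 2 + d * (j : ℝ) ^ 3) =
    a * k + b * (k * (k - 1) / 2) + c * (k * (k - 1) * (2 * k - 1) / 6) + d * (k * (k - 1) / 2) ^ 2 := by
  induction k with
  | zero => simp
  | succ k ih =>
    rw [Finset.sum_range_succ, ih]
    push_cast
    ring

lemma D_nonneg (n m : ℕ) (h1 : 1 ≤ m) (h : m < n) (hb : 3 * bcost n - 1 / 2 ≤ m) :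
    0 ≤ Ddisc n m := by
  have hm1 : (1 : ℝ) ≤ m := by exact_mod_cast h1
  have hmn : (m : ℝ) < n := by exact_mod_cast h
  have hu : (0 : ℝ) < n - (m - 1) / 3 := by linarith
  have hz : ∑ j ∈ Finset.range m, (n : ℝ) / (n - (m - 1) / 3) *
      (((m : ℝ) - j) * (3 * j - m + 1) / 6) = 0 := by
    rw [← Finset.mul_sum]
    have := sum_poly m ((m : ℝ) * (1 - m) / 6) ((4 * m - 1) / 6) (-1 / 2) 0
    have e : ∑ j ∈ Finset.range m, (((m : ℝ) - j) * (3 * j - m + 1) / 6) =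
      ∑ j ∈ Finset.range m, ((m : ℝ) * (1 - m) / 6 + (4 * m - 1) / 6 * (j : ℝ) + (-1 / 2) * (j : ℝ) ^ 2 + 0 * (j : ℝ) ^ 3) := by
      apply Finset.sum_congr rfl
      intro j _
      ring
    rw [e, this]
    ring
  rw [← hz]
  unfold Ddisc
  apply Finset.sum_le_sum
  intro j hj
  have hj1 : (j : ℝ) < m := by exact_mod_cast Finset.mem_range.mp hj
  have hx : (0 : ℝ) < n - j := by linarith
  have hn0 : (0 : ℝ) < n := by linarith
  have s1 : (n : ℝ) / (n - j) * (((m : ℝ) - j) * (3 * j - m + 1) / 6) ≤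
      (n : ℝ) / ((n : ℝ) - j) * (((m : ℝ) - j) * (((m : ℝ) + j + 1) / 2 - 2 * bcost n)) := by
    apply mul_le_mul_of_nonneg_left _ (by positivity)
    rw [mul_div_assoc]
    apply mul_le_mul_of_nonneg_left _ (by linarith)
    linarith
  refine le_trans ?_ s1
  have : (n : ℝ) / (n - j) * (((m : ℝ) - j) * (3 * j - m + 1) / 6) -
      (n : ℝ) / (n - (m - 1) / 3) * (((m : ℝ) - j) * (3 * j - m + 1) / 6) =
      n * (m - j) * (j - (m - 1) / 3) ^ 2 / 2 / ((n - j) * (n - (m - 1) / 3)) := by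
    generalize hU : (n : ℝ) - (m - 1) / 3 = U at *
    generalize hX : (n : ℝ) - j = X at *
    have q : (3 * j - m + 1 : ℝ) = 3 * (U - X) := by rw [← hU, ← hX]; ring
    have q2 : (j - (m - 1) / 3 : ℝ) = (U - X) := by rw [← hU, ← hX]; ring
    rw [q, q2]
    field_simp
    ring
  have p : 0 ≤ n * (m - j) * (j - (m - 1) / 3) ^ 2 / 2 / ((n - j) * (n - (m - 1) / 3) : ℝ) := by
    have : (0 : ℝ) ≤ m - j := by linarith
    positivity
  linarith

lemma G_chord (n m : ℕ) (hn : 5 ≤ n) (h1 : 1 ≤ m) (hc : m ^ 2 + 25 * m + 6 ≤ 24 * n) :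
    ∑ j ∈ Finset.range m, (((m : ℝ) - j) * (3 * j - m - 3)) / ((n : ℝ) - j) ≤ 0 := by
  have hm1 : (1 : ℝ) ≤ m := by exact_mod_cast h1
  have hcr : (m : ℝ) ^ 2 + 25 * m + 6 ≤ 24 * n := by exact_mod_cast hc
  have hmn : (m : ℝ) < n := by nlinarith
  have hnr : (5 : ℝ) ≤ n := by exact_mod_cast hn
  have hu : (0 : ℝ) < n - (m + 3) / 3 := by linarith
  have hv : (0 : ℝ) < n - m + 1 := by linarith
  have hs : ∑ j ∈ Finset.range m, (((m : ℝ) - j) * (3 * j - m - 3)) * (n - 4 * m / 3 + j) ≤ 0 := by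
    have := sum_poly m (-(m : ℝ) * (m + 3) * (n - 4 * m / 3))
      ((4 * m + 3) * (n - 4 * m / 3) - m * (m + 3)) (-3 * (n - 4 * m / 3) + (4 * m + 3)) (-3)
    have e : ∑ j ∈ Finset.range m, (((m : ℝ) - j) * (3 * j - m - 3)) * (n - 4 * m / 3 + j) =
      ∑ j ∈ Finset.range m, ((-(m : ℝ) * (m + 3) * (n - 4 * m / 3)) +
      ((4 * m + 3) * (n - 4 * m / 3) - m * (m + 3)) * (j : ℝ) + (-3 * (n - 4 * m / 3) + (4 * m + 3)) * (j : ℝ) ^ 2 + (-3) * (j : ℝ) ^ 3) := by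
      apply Finset.sum_congr rfl
      intro j _
      ring
    rw [e, this]
    have : 0 ≤ (m : ℝ) * (m + 1) * (24 * n - (m ^ 2 + 25 * m + 6)) :=
      mul_nonneg (by positivity) (by linarith)
    nlinarith
  have hle : ∑ j ∈ Finset.range m, (((m : ℝ) - j) * (3 * j - m - 3)) / ((n : ℝ) - j) ≤
    ∑ j ∈ Finset.range m, ((((m : ℝ) - j) * (3 * j - m - 3)) * (n - 4 * m / 3 + j)) /
      ((n - (m + 3) / 3) * (n - m + 1)) := by
    apply Finset.sum_le_sum
    intro j hj
    have hj0 : j + 1 ≤ m := Finset.mem_range.mp hj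
    have hj1 : (j : ℝ) + 1 ≤ m := by exact_mod_cast hj0
    have hx : (0 : ℝ) < n - j := by linarith
    rw [div_le_div_iff₀ hx (by positivity)]
    have : 0 ≤ ((m : ℝ) - j) * (3 * j - m - 3) ^ 2 * (m - 1 - j) :=
      mul_nonneg (mul_nonneg (by linarith) (by positivity)) (by linarith)
    nlinarith
  refine hle.trans ?_
  rw [← Finset.sum_div]
  exact div_nonpos_of_nonpos_of_nonneg hs (by positivity)

lemma D_neg (n m : ℕ) (h1 : 1 ≤ m) (h : m < n) (hb : (m : ℝ) < 3 * bcost n - 3 / 2)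
    (hG : ∑ j ∈ Finset.range m, (((m : ℝ) - j) * (3 * j - m - 3)) / ((n : ℝ) - j) ≤ 0) :
    Ddisc n m < 0 := by
  have hmn : (m : ℝ) < n := by exact_mod_cast h
  have hn0 : (0 : ℝ) < n := lt_of_le_of_lt (by positivity) hmn
  have hlt : Ddisc n m < ∑ j ∈ Finset.range m,
      (n / 6 : ℝ) * ((((m : ℝ) - j) * (3 * j - m - 3)) / ((n : ℝ) - j)) := by
    unfold Ddisc
    apply Finset.sum_lt_sum_of_nonempty ⟨0, Finset.mem_range.mpr h1⟩
    intro j hj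
    have hj1 : (j : ℝ) < m := by exact_mod_cast Finset.mem_range.mp hj
    have hx : (0 : ℝ) < n - j := by linarith
    have hy : (0 : ℝ) < m - j := by linarith
    have e : (n / 6 : ℝ) * ((((m : ℝ) - j) * (3 * j - m - 3)) / ((n : ℝ) - j)) =
      n / (n - j) * ((m - j) * ((3 * j - m - 3) / 6)) := by
      field_simp
    rw [e]
    apply mul_lt_mul_of_pos_left _ (by positivity)
    apply mul_lt_mul_of_pos_left _ hy
    linarith
  rw [← Finset.mul_sum] at hlt
  have : (n / 6 : ℝ) * ∑ j ∈ Finset.range m, (((m : ℝ) - j) * (3 * j - m - 3)) / ((n : ℝ) - j) ≤ 0 :=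
    mul_nonpos_of_nonneg_of_nonpos (by positivity) hG
  linarith

lemma logb_le (n p q : ℕ) (hq : 0 < q) (h : (n + 1) ^ q ≤ 2 ^ p) :
    Real.logb 2 ((n : ℝ) + 1) ≤ p / q := by
  have hq' : (0 : ℝ) < q := by exact_mod_cast hq
  rw [le_div_iff₀ hq', mul_comm]
  have h2 : ((n : ℝ) + 1) ^ q ≤ 2 ^ p := by exact_mod_cast h
  have h3 : Real.logb 2 (((n : ℝ) + 1) ^ q) ≤ Real.logb 2 (2 ^ p) :=
    Real.logb_le_logb_of_le (by norm_num) (by positivity) h2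
  rw [Real.logb_pow, Real.logb_pow, Real.logb_self_eq_one (by norm_num), mul_one] at h3
  exact h3

lemma pow_bound (k : ℕ) (hk : 5 ≤ k) :
    (3.1 * (k : ℝ) - 1.4) ^ 2 + 25 * (3.1 * (k : ℝ) - 1.4) + 6 ≤ 24 * (2 ^ k - 1) := by
  induction k, hk using Nat.le_induction with
  | base => norm_num
  | succ k hk ih =>
    have : (5 : ℝ) ≤ k := by exact_mod_cast hk
    push_cast
    rw [pow_succ (2 : ℝ) k]
    nlinarith

lemma big_case (n m : ℕ) (hn : 31 ≤ n) (hb : (m : ℝ) < 3 * bcost n - 3 / 2) :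
    m ^ 2 + 25 * m + 6 ≤ 24 * n := by
  set k := Nat.log 2 (n + 1) with hkdef
  have hk1 : 2 ^ k ≤ n + 1 := Nat.pow_log_le_self 2 (by omega)
  have hk2 : n + 1 < 2 ^ (k + 1) := Nat.lt_pow_succ_log_self (by norm_num) _
  have hk5 : 5 ≤ k := Nat.le_log_of_pow_le (by norm_num) (by omega)
  have hL := logb_le n (k + 1) 1 (by norm_num) (by simpa using hk2.le)
  have hnr : (31 : ℝ) ≤ n := by exact_mod_cast hn
  have hk5r : (5 : ℝ) ≤ k := by exact_mod_cast hk5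
  have hinv : 1 / (n : ℝ) ≤ 1 / 31 := one_div_le_one_div_of_le (by norm_num) hnr
  have hk1r : (2 : ℝ) ^ k ≤ n + 1 := by exact_mod_cast hk1
  have hp := pow_bound k hk5
  push_cast at hL
  rw [div_one] at hL
  have hm : (m : ℝ) ≤ 3.1 * k - 1.4 := by
    unfold bcost at hb
    have : (1 + 1 / (n : ℝ)) * Real.logb 2 ((n : ℝ) + 1) ≤ (1 + 1 / 31) * (k + 1) :=
      mul_le_mul (by linarith) hL (Real.logb_nonneg (by norm_num) (by linarith)) (by norm_num)
    linarith
  have hm0 : (0 : ℝ) ≤ m := by positivity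
  have : (m : ℝ) ^ 2 + 25 * m + 6 ≤ 24 * n := by nlinarith
  exact_mod_cast this

lemma small_le (n m p q M : ℕ) (hn : 0 < n) (hq : 0 < q) (h : (n + 1) ^ q ≤ 2 ^ p)
    (hb : (m : ℝ) < 3 * bcost n - 3 / 2)
    (hM : 6 * (n + 1) * p ≤ (2 * (M + 1) + 9) * n * q) : m ≤ M := by
  have hL := logb_le n p q hq h
  have hn' : (0 : ℝ) < n := by exact_mod_cast hn
  have hq' : (0 : ℝ) < q := by exact_mod_cast hq
  have hM' : (6 * (n + 1) * p : ℝ) ≤ (2 * (M + 1) + 9) * n * q := by exact_mod_cast hM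
  have h1 : (1 + 1 / (n : ℝ)) * Real.logb 2 ((n : ℝ) + 1) ≤ (1 + 1 / n) * (p / q) :=
    mul_le_mul_of_nonneg_left hL (by positivity)
  have h2 : (1 + 1 / (n : ℝ)) * (p / q) ≤ (2 * (M + 1) + 9) / 6 := by
    have : (1 + 1 / (n : ℝ)) * (p / q) = ((n + 1) * p) / (n * q) := by field_simp
    rw [this, div_le_div_iff₀ (by positivity) (by norm_num)]
    nlinarith
  unfold bcost at hb
  have : (m : ℝ) < (M + 1 : ℕ) := by push_cast; linarith
  have : m < M + 1 := by exact_mod_cast this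
  omega

lemma cases_bound (n m : ℕ) (hn : 5 ≤ n) (hb : (m : ℝ) < 3 * bcost n - 3 / 2) :
    m ^ 2 + 25 * m + 6 ≤ 24 * n ∨ (n = 5 ∧ m = 4) ∨ (n = 6 ∧ m = 5) := by
  by_cases h31 : 31 ≤ n
  · exact Or.inl (big_case n m h31 hb)
  push Not at h31
  by_cases h17 : 17 ≤ n
  · left
    have := small_le n m 5 1 11 (by omega) (by norm_num) (by rw [pow_one]; omega) hb (by omega)
    nlinarith
  push Not at h17
  have fin : ∀ M, m ≤ M → M ^ 2 + 25 * M + 6 ≤ 24 * n → m ^ 2 + 25 * m + 6 ≤ 24 * n := by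
    intro M h1 h2
    nlinarith
  interval_cases n
  · have := small_le 5 m 13 5 4 (by norm_num) (by norm_num) (by norm_num) hb (by norm_num)
    interval_cases m <;> simp
  · have := small_le 6 m 3 1 5 (by norm_num) (by norm_num) (by norm_num) hb (by norm_num)
    interval_cases m <;> simp
  · exact Or.inl (fin 5 (small_le _ m 3 1 5 (by norm_num) (by norm_num) (by norm_num) hb (by norm_num)) (by norm_num))
  · exact Or.inl (fin 6 (small_le _ m 16 5 6 (by norm_num) (by norm_num) (by norm_num) hb (by norm_num)) (by norm_num))
  · exact Or.inl (fin 6 (small_le _ m 10 3 6 (by norm_num) (by norm_num) (by norm_num) hb (by norm_num)) (by norm_num))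
  · exact Or.inl (fin 7 (small_le _ m 7 2 7 (by norm_num) (by norm_num) (by norm_num) hb (by norm_num)) (by norm_num))
  · exact Or.inl (fin 7 (small_le _ m 11 3 7 (by norm_num) (by norm_num) (by norm_num) hb (by norm_num)) (by norm_num))
  · exact Or.inl (fin 8 (small_le _ m 4 1 8 (by norm_num) (by norm_num) (by norm_num) hb (by norm_num)) (by norm_num))
  · exact Or.inl (fin 8 (small_le _ m 4 1 8 (by norm_num) (by norm_num) (by norm_num) hb (by norm_num)) (by norm_num))
  · exact Or.inl (fin 8 (small_le _ m 4 1 8 (by norm_num) (by norm_num) (by norm_num) hb (by norm_num)) (by norm_num))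
  · exact Or.inl (fin 8 (small_le _ m 4 1 8 (by norm_num) (by norm_num) (by norm_num) hb (by norm_num)) (by norm_num))
  · exact Or.inl (fin 9 (small_le _ m 9 2 9 (by norm_num) (by norm_num) (by norm_num) hb (by norm_num)) (by norm_num))

lemma bcost_ge (n : ℕ) (hn : 5 ≤ n) : 1 ≤ bcost n := by
  have hnr : (5 : ℝ) ≤ n := by exact_mod_cast hn
  have h : (2 : ℝ) ≤ Real.logb 2 ((n : ℝ) + 1) := by
    rw [Real.le_logb_iff_rpow_le (by norm_num) (by linarith)]
    norm_num
    linarith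
  have h2 : 0 ≤ 1 / (n : ℝ) := by positivity
  unfold bcost
  nlinarith

/-- For `n ≥ 5`, the smallest `m ∈ {1,…,n}` at which `F̃` attains its minimum over
`{1,…,n}` (the quantity `m̃_opt(n)`) satisfies `3·b(n) − 3/2 ≤ m̃_opt(n) < 3·b(n) + 1/2`. -/
theorem mtilde_opt_bounds (n : ℕ) (hn : 5 ≤ n) (m : ℕ) (hm : m ∈ Finset.Icc 1 n)
    (hmin : ∀ m' ∈ Finset.Icc 1 n, Ftilde n m ≤ Ftilde n m')
    (hsmall : ∀ m' ∈ Finset.Icc 1 n, (∀ m'' ∈ Finset.Icc 1 n, Ftilde n m' ≤ Ftilde n m'') →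
      m ≤ m') :
    3 * bcost n - 3 / 2 ≤ (m : ℝ) ∧ (m : ℝ) < 3 * bcost n + 1 / 2 := by
  obtain ⟨hm1, hmn⟩ := Finset.mem_Icc.mp hm
  constructor
  · by_contra hb
    push Not at hb
    have hc := cases_bound n m hn hb
    have hlt : m < n := by
      rcases hc with h | h | h
      · nlinarith
      · omega
      · omega
    have hG : ∑ j ∈ Finset.range m, (((m : ℝ) - j) * (3 * j - m - 3)) / ((n : ℝ) - j) ≤ 0 := by
      rcases hc with h | ⟨rfl, rfl⟩ | ⟨rfl, rfl⟩
      · exact G_chord n m hn hm1 h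
      · norm_num [Finset.sum_range_succ]
      · norm_num [Finset.sum_range_succ]
    have hD := D_neg n m hm1 hlt hb hG
    have hd := diff_eq n m hm1 hlt
    have hltr : (m : ℝ) < n := by exact_mod_cast hlt
    have hneg : Ddisc n m / (((n : ℝ) - m) * Ewait n m * Ewait n (m + 1)) < 0 :=
      div_neg_of_neg_of_pos hD (mul_pos (mul_pos (by linarith) (Ewait_pos n m hm1 hmn))
        (Ewait_pos n (m + 1) (by omega) (by omega)))
    have := hmin (m + 1) (Finset.mem_Icc.mpr ⟨by omega, by omega⟩)
    linarith
  · by_contra hb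
    push Not at hb
    have hb1 := bcost_ge n hn
    have hm2r : (1 : ℝ) < m := by linarith
    have hm2 : 1 < m := by exact_mod_cast hm2r
    obtain ⟨k, rfl⟩ : ∃ k, m = k + 1 := ⟨m - 1, by omega⟩
    push_cast at hb
    have hk1 : 1 ≤ k := by omega
    have hkn : k < n := by omega
    have hD := D_nonneg n k hk1 hkn (by linarith)
    have hd := diff_eq n k hk1 hkn
    have hltr : (k : ℝ) < n := by exact_mod_cast hkn
    have hpos : 0 ≤ Ddisc n k / (((n : ℝ) - k) * Ewait n k * Ewait n (k + 1)) :=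
      div_nonneg hD (mul_pos (mul_pos (by linarith) (Ewait_pos n k hk1 hkn.le))
        (Ewait_pos n (k + 1) (by omega) (by omega))).le
    have := hsmall k (Finset.mem_Icc.mpr ⟨hk1, hkn.le⟩) (fun m'' h'' => by
      have := hmin m'' h''
      linarith)
    omega
end
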